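/- (Interior sup bound.) Let u be a classical solution of the regularized problem, and suppose there is a nondecreasing K : (0,T] → (0,∞) with ∂_t u(t,x) ≥ −(u(t,x) + 1/n)/K(t) for all (t,x) ∈ (0,T] × (a,b). Fix 0 < t₀ ≤ T and a < d₁ ≤ d₂ < b, set r = min(d₁ − a, b − d₂), N = 1/(K(t₀)·ρ_λ(a)) + sup_{x∈(a,b)} |g(x)|, and let C₁ ≥ ∫_a^b u(t,x) dx for every t ∈ [t₀,T]. Then for all t ∈ [t₀,T] and x ∈ [d₁,d₂], u(t,x) ≤ 2·C₁/r + (N/2)·r². -/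

import Mathlib

open MeasureTheory Set

noncomputable def rho (lam x : ℝ) : ℝ := Real.sqrt x * (x + lam) * Real.sqrt (x + 2 * lam)

/-- `u` is a classical solution of the regularized Dirichlet problem on `[0,T] × [a,b]`:
nonnegative, continuous, C¹ in time, C² in space, solving
`∂ₜu = ρ_λ(x)(u + 1/n)∂ₓ²u + ρ_λ(x) g(x) (u + 1/n)` with zero lateral boundary data
and initial data `u₀`. -/
structure IsRegSolution (lam a b T : ℝ) (n : ℕ) (g u₀ : ℝ → ℝ) (u : ℝ → ℝ → ℝ) : Prop where
  nonneg : ∀ t ∈ Icc (0:ℝ) T, ∀ x ∈ Icc a b, 0 ≤ u t x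
  cont : ContinuousOn (fun p : ℝ × ℝ => u p.1 p.2) (Icc (0:ℝ) T ×ˢ Icc a b)
  diff_t : ∀ t ∈ Icc (0:ℝ) T, ∀ x ∈ Icc a b, DifferentiableAt ℝ (fun s => u s x) t
  diff_x : ∀ t ∈ Icc (0:ℝ) T, ∀ x ∈ Icc a b, DifferentiableAt ℝ (fun y => u t y) x
  diff_xx : ∀ t ∈ Icc (0:ℝ) T, ∀ x ∈ Icc a b, DifferentiableAt ℝ (deriv (fun y => u t y)) x
  cont_dt : ContinuousOn (fun p : ℝ × ℝ => deriv (fun s => u s p.2) p.1) (Icc (0:ℝ) T ×ˢ Icc a b)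
  cont_dx : ContinuousOn (fun p : ℝ × ℝ => deriv (fun y => u p.1 y) p.2) (Icc (0:ℝ) T ×ˢ Icc a b)
  cont_dxx : ContinuousOn (fun p : ℝ × ℝ => deriv (deriv (fun y => u p.1 y)) p.2) (Icc (0:ℝ) T ×ˢ Icc a b)
  eqn : ∀ t ∈ Icc (0:ℝ) T, ∀ x ∈ Ioo a b,
    deriv (fun s => u s x) t =
      rho lam x * (u t x + 1 / (n:ℝ)) * deriv (deriv (fun y => u t y)) x
        + rho lam x * g x * (u t x + 1 / (n:ℝ))
  bdry_a : ∀ t ∈ Icc (0:ℝ) T, u t a = 0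
  bdry_b : ∀ t ∈ Icc (0:ℝ) T, u t b = 0
  init : ∀ x ∈ Icc a b, u 0 x = u₀ x

/-- A function with `f'' ≥ -N` is bounded at the midpoint of an interval by the average of its
endpoint values plus `N / 2 * s ^ 2`. -/
theorem two_mul_le_of_neg_le_deriv2 {f : ℝ → ℝ} {a b N x s : ℝ}
    (hf : ∀ y ∈ Icc a b, DifferentiableAt ℝ f y)
    (hf' : ∀ y ∈ Icc a b, DifferentiableAt ℝ (deriv f) y)
    (hN : ∀ y ∈ Ioo a b, -N ≤ deriv (deriv f) y)
    (hl : x - s ∈ Icc a b) (hr : x + s ∈ Icc a b) :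
    2 * f x ≤ f (x + s) + f (x - s) + N * s ^ 2 := by
  have hconv : ConvexOn ℝ (Icc a b) (fun y => f y + N / 2 * (y - x) ^ 2) := by
    refine convexOn_of_hasDerivWithinAt2_nonneg (convex_Icc a b)
      (f' := fun y => deriv f y + N * (y - x)) (f'' := fun y => deriv (deriv f) y + N) ?_ ?_ ?_ ?_
    · exact ContinuousOn.add (fun y hy => (hf y hy).continuousAt.continuousWithinAt) (by fun_prop)
    · intro y hy
      have h := (hf y (interior_subset hy)).hasDerivAt.add
        ((((hasDerivAt_id y).sub_const x).pow 2).const_mul (N / 2))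
      refine (h.congr_deriv ?_).hasDerivWithinAt
      simp
      ring
    · intro y hy
      have h := (hf' y (interior_subset hy)).hasDerivAt.add
        (((hasDerivAt_id y).sub_const x).const_mul N)
      exact (h.congr_deriv (by simp)).hasDerivWithinAt
    · intro y hy
      rw [interior_Icc] at hy
      linarith [hN y hy]
  have h := hconv.2 hl hr (by norm_num : (0 : ℝ) ≤ 1 / 2) (by norm_num : (0 : ℝ) ≤ 1 / 2) (by norm_num)
  have hx : (1 / 2 : ℝ) * (x - s) + 1 / 2 * (x + s) = x := by ring
  simp only [smul_eq_mul, hx] at h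
  nlinarith [h]

/-- A nonnegative function with `f'' ≥ -N` is bounded in the interior by its integral. -/
theorem two_mul_mul_le_integral_of_neg_le_deriv2 {f : ℝ → ℝ} {a b N x r : ℝ}
    (hf : ∀ y ∈ Icc a b, DifferentiableAt ℝ f y)
    (hf' : ∀ y ∈ Icc a b, DifferentiableAt ℝ (deriv f) y)
    (hf0 : ∀ y ∈ Icc a b, 0 ≤ f y)
    (hN : ∀ y ∈ Ioo a b, -N ≤ deriv (deriv f) y)
    (hr : 0 ≤ r) (hl : a ≤ x - r) (hu : x + r ≤ b) :
    2 * r * f x ≤ (∫ y in Ioo a b, f y) + N * r ^ 3 / 3 := by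
  have hc : ContinuousOn f (Icc a b) :=
    fun y hy => (hf y hy).continuousAt.continuousWithinAt
  have hint : ∀ c d, a ≤ c → c ≤ d → d ≤ b → IntervalIntegrable f volume c d :=
    fun c d hac hcd hdb =>
      (hc.mono (by rw [uIcc_of_le hcd]; exact Icc_subset_Icc hac hdb)).intervalIntegrable
  have hp : IntervalIntegrable (fun s => f (x + s)) volume 0 r := by
    refine ContinuousOn.intervalIntegrable (hc.comp (by fun_prop) ?_)
    intro s hs
    rw [uIcc_of_le hr] at hs
    exact ⟨by linarith [hs.1], by linarith [hs.2]⟩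
  have hm : IntervalIntegrable (fun s => f (x - s)) volume 0 r := by
    refine ContinuousOn.intervalIntegrable (hc.comp (by fun_prop) ?_)
    intro s hs
    rw [uIcc_of_le hr] at hs
    exact ⟨by linarith [hs.2], by linarith [hs.1]⟩
  have hq : IntervalIntegrable (fun s : ℝ => N * s ^ 2) volume 0 r :=
    Continuous.intervalIntegrable (by fun_prop) _ _
  have hmono := intervalIntegral.integral_mono_on (μ := volume) (f := fun _ => 2 * f x)
    (g := fun s => f (x + s) + f (x - s) + N * s ^ 2) hr
    (by simp) ((hp.add hm).add hq) (fun s hs => two_mul_le_of_neg_le_deriv2 hf hf' hN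
      ⟨by linarith [hs.2], by linarith [hs.1]⟩ ⟨by linarith [hs.1], by linarith [hs.2]⟩)
  rw [intervalIntegral.integral_add (hp.add hm) hq, intervalIntegral.integral_add hp hm,
    intervalIntegral.integral_comp_add_left, intervalIntegral.integral_comp_sub_left,
    intervalIntegral.integral_const, intervalIntegral.integral_const_mul, integral_pow,
    add_zero, sub_zero, smul_eq_mul] at hmono
  have hadj := intervalIntegral.integral_add_adjacent_intervals
    (hint (x - r) x hl (by linarith) (by linarith))
    (hint x (x + r) (by linarith) (by linarith) hu)
  have hsub : (∫ y in (x - r)..(x + r), f y) ≤ ∫ y in Ioo a b, f y := by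
    rw [intervalIntegral.integral_of_le (by linarith), integral_Ioc_eq_integral_Ioo]
    refine setIntegral_mono_set (hc.integrableOn_Icc.mono_set Ioo_subset_Icc_self) ?_
      (Ioo_subset_Ioo hl hu).eventuallyLE
    exact (ae_restrict_iff' measurableSet_Ioo).2
      (Filter.Eventually.of_forall fun y hy => hf0 y (Ioo_subset_Icc_self hy))
  norm_num at hmono
  linarith

theorem rho_pos {lam x : ℝ} (hlam : 0 ≤ lam) (hx : 0 < x) : 0 < rho lam x := by
  unfold rho
  positivity

theorem rho_le_rho {lam x y : ℝ} (hlam : 0 ≤ lam) (hx : 0 < x) (hxy : x ≤ y) :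
    rho lam x ≤ rho lam y := by
  unfold rho
  have : 0 < y := hx.trans_le hxy
  gcongr

/-- Interior sup bound: with a nondecreasing `K > 0` satisfying the Benilan–Crandall
inequality, `r = min(d₁-a, b-d₂)`, `N = 1/(K(t₀)ρ_λ(a)) + sup_{(a,b)}|g|`, and
`C₁ ≥ ∫ u(t) dx` for `t ∈ [t₀,T]`, one has `u(t,x) ≤ 2C₁/r + (N/2)r²` on
`[t₀,T] × [d₁,d₂]`. -/
theorem interior_sup_bound
    (lam a b T : ℝ) (n : ℕ) (hlam : 0 ≤ lam) (ha : 0 < a) (hab : a < b) (hT : 0 < T)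
    (hn : 1 ≤ n) (g u₀ : ℝ → ℝ) (hg : ContinuousOn g (Icc a b))
    (hgbdd : BddAbove ((fun x => |g x|) '' Ioo a b))
    (hu₀c : ContinuousOn u₀ (Icc a b)) (hu₀nn : ∀ x ∈ Icc a b, 0 ≤ u₀ x)
    (hu₀a : u₀ a = 0) (hu₀b : u₀ b = 0)
    (u : ℝ → ℝ → ℝ) (hu : IsRegSolution lam a b T n g u₀ u)
    (K : ℝ → ℝ) (hKpos : ∀ t ∈ Ioc (0:ℝ) T, 0 < K t) (hKmono : MonotoneOn K (Ioc 0 T))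
    (hBC : ∀ t ∈ Ioc (0:ℝ) T, ∀ x ∈ Ioo a b,
      deriv (fun s => u s x) t ≥ -((u t x + 1 / (n:ℝ)) / K t))
    (t₀ d₁ d₂ r N Mg C₁ : ℝ) (ht₀ : 0 < t₀) (ht₀T : t₀ ≤ T)
    (hd₁ : a < d₁) (hd₁₂ : d₁ ≤ d₂) (hd₂ : d₂ < b)
    (hr : r = min (d₁ - a) (b - d₂))
    (hMg : IsLUB ((fun x => |g x|) '' Ioo a b) Mg)
    (hN : N = 1 / (K t₀ * rho lam a) + Mg)
    (hC₁ : ∀ t ∈ Icc t₀ T, (∫ x in Ioo a b, u t x) ≤ C₁) :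
    ∀ t ∈ Icc t₀ T, ∀ x ∈ Icc d₁ d₂,
      u t x ≤ 2 * C₁ / r + (N / 2) * r ^ 2 := by
  intro t ht x hx
  have htT : t ∈ Icc (0 : ℝ) T := ⟨ht₀.le.trans ht.1, ht.2⟩
  have htT' : t ∈ Ioc (0 : ℝ) T := ⟨ht₀.trans_le ht.1, ht.2⟩
  have hK₀ : 0 < K t₀ := hKpos t₀ ⟨ht₀, ht₀T⟩
  have hK : K t₀ ≤ K t := hKmono ⟨ht₀, ht₀T⟩ htT' ht.1
  have hρa : 0 < rho lam a := rho_pos hlam ha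
  have hg_le : ∀ y ∈ Ioo a b, |g y| ≤ Mg := fun y hy => hMg.1 (mem_image_of_mem _ hy)
  have hMg0 : 0 ≤ Mg :=
    (abs_nonneg _).trans (hg_le ((a + b) / 2) ⟨by linarith, by linarith⟩)
  have hN0 : 0 ≤ N := by
    rw [hN]
    positivity
  have hr0 : 0 < r := by
    rw [hr]
    exact lt_min (by linarith) (by linarith)
  have hr₁ : r ≤ d₁ - a := hr ▸ min_le_left _ _
  have hr₂ : r ≤ b - d₂ := hr ▸ min_le_right _ _
  have hC0 : 0 ≤ C₁ :=
    (setIntegral_nonneg measurableSet_Ioo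
      fun y hy => hu.nonneg t htT y (Ioo_subset_Icc_self hy)).trans (hC₁ t ht)
  have hlower : ∀ y ∈ Ioo a b, -N ≤ deriv (deriv (fun z => u t z)) y := by
    intro y hy
    have hρ : 0 < rho lam y := rho_pos hlam (ha.trans hy.1)
    have hw : 0 < u t y + 1 / (n : ℝ) := by
      have h1 := hu.nonneg t htT y (Ioo_subset_Icc_self hy)
      have h2 : (0 : ℝ) < n := by exact_mod_cast hn
      positivity
    have hKt : 0 < K t := hK₀.trans_le hK
    have hb := hBC t htT' y hy
    rw [hu.eqn t htT y hy] at hb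
    have hdiv : -(1 / (K t * rho lam y)) ≤ deriv (deriv (fun z => u t z)) y + g y := by
      refine le_of_mul_le_mul_left ?_ (mul_pos hρ hw)
      calc rho lam y * (u t y + 1 / (n : ℝ)) * -(1 / (K t * rho lam y))
          = -((u t y + 1 / (n : ℝ)) / K t) := by field_simp
        _ ≤ _ := by linarith
    have hcoef : 1 / (K t * rho lam y) ≤ 1 / (K t₀ * rho lam a) :=
      one_div_le_one_div_of_le (mul_pos hK₀ hρa)
        (mul_le_mul hK (rho_le_rho hlam ha hy.1.le) hρa.le hKt.le)
    linarith [(le_abs_self (g y)).trans (hg_le y hy)]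
  have hmain := two_mul_mul_le_integral_of_neg_le_deriv2 (x := x) (hu.diff_x t htT)
    (hu.diff_xx t htT) (hu.nonneg t htT) hlower hr0.le (by linarith [hx.1]) (by linarith [hx.2])
  have hbound : 2 * r * u t x ≤ 2 * r * (2 * C₁ / r + N / 2 * r ^ 2) := by
    have hexp : 2 * r * (2 * C₁ / r + N / 2 * r ^ 2) = 4 * C₁ + N * r ^ 3 := by field_simp; ring
    have hNr : 0 ≤ N * r ^ 3 := by positivity
    linarith [hC₁ t ht]
  exact le_of_mul_le_mul_left hbound (by positivity)
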